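/- Let q be an odd prime power. Define polynomials over F_q by F_0(X) = X, F_k(X) = F_{k−1}(X)^2 + X for k ≥ 1, and G_{j,−1}(X) = −F_j(X) − X. Then for any nonempty finite set J of positive integers, the product ∏_{j ∈ J} G_{j,−1} is not equal to P^2 for any polynomial P with coefficients in the algebraic closure of F_q. -/

import Mathlib

/-- The iterates `F_0(X) = X`, `F_k(X) = F_{k-1}(X)^2 + X`. -/
noncomputable def Fiter (F : Type*) [Field F] : ℕ → Polynomial F
  | 0 => Polynomial.X
  | (k + 1) => (Fiter F k) ^ 2 + Polynomial.X

/-- The polynomials `G_{j,−1}(X) = −F_j(X) − X`. -/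
noncomputable def Gpoly (F : Type*) [Field F] (j : ℕ) : Polynomial F :=
  -Fiter F j - Polynomial.X

open Polynomial

/-- The polynomials `E_k` with `F_k = X * E_k`. -/
noncomputable def reducedIter (K : Type*) [Field K] : ℕ → K[X]
  | 0 => 1
  | (k + 1) => 1 + X * reducedIter K k ^ 2

/-- The cofactor of `-X` in `G_{k + 1, -1}`. -/
noncomputable def preperiodicPoly (K : Type*) [Field K] (k : ℕ) : K[X] :=
  X * reducedIter K k ^ 2 + 2

/-- The combination `E_k - t 2⁻ᵏ (X E_k)'`. -/
noncomputable def twistedDeriv {K : Type*} [Field K] (t : K) (k : ℕ) : K[X] :=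
  reducedIter K k - C (t * 2⁻¹ ^ k) * derivative (X * reducedIter K k)

/-- The form `B w_k² - X v² E_k²`, where `w_k = twistedDeriv t k`. -/
noncomputable def pellForm {K : Type*} [Field K] (t : K) (B v : K[X]) (k : ℕ) : K[X] :=
  B * twistedDeriv t k ^ 2 - X * v ^ 2 * reducedIter K k ^ 2

section Basic

variable {K : Type*} [Field K]

lemma X_mul_reducedIter (k : ℕ) : X * reducedIter K k = Fiter K k := by
  induction k with
  | zero => simp [reducedIter, Fiter]
  | succ k ih => rw [reducedIter, Fiter, ← ih]; ring

lemma Gpoly_succ (k : ℕ) : Gpoly K (k + 1) = -(X * preperiodicPoly K k) := by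
  rw [Gpoly, Fiter, ← X_mul_reducedIter, preperiodicPoly]; ring

lemma monic_reducedIter (k : ℕ) :
    (reducedIter K k).Monic ∧ (reducedIter K k).natDegree + 1 = 2 ^ k := by
  induction k with
  | zero => simp [reducedIter]
  | succ k ih =>
    have hm : (X * reducedIter K k ^ 2).Monic := monic_X.mul (ih.1.pow 2)
    have hd : (X * reducedIter K k ^ 2).natDegree = 1 + 2 * (reducedIter K k).natDegree := by
      rw [monic_X.natDegree_mul (ih.1.pow 2), ih.1.natDegree_pow, natDegree_X]
    have hlt : (1 : K[X]).degree < (X * reducedIter K k ^ 2).degree := by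
      rw [degree_one, degree_eq_natDegree hm.ne_zero, hd]
      exact_mod_cast (by omega : 0 < 1 + 2 * (reducedIter K k).natDegree)
    refine ⟨hm.add_of_right hlt, ?_⟩
    rw [reducedIter, natDegree_add_eq_right_of_degree_lt hlt, hd, pow_succ, ← ih.2]
    ring

lemma monic_preperiodicPoly (k : ℕ) :
    (preperiodicPoly K k).Monic ∧ (preperiodicPoly K k).natDegree + 1 = 2 ^ (k + 1) := by
  have ih := monic_reducedIter (K := K) k
  have hm : (X * reducedIter K k ^ 2).Monic := monic_X.mul (ih.1.pow 2)
  have hd : (X * reducedIter K k ^ 2).natDegree = 1 + 2 * (reducedIter K k).natDegree := by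
    rw [monic_X.natDegree_mul (ih.1.pow 2), ih.1.natDegree_pow, natDegree_X]
  have hlt : (2 : K[X]).degree < (X * reducedIter K k ^ 2).degree := by
    refine lt_of_le_of_lt (degree_C_le (a := (2 : K))) ?_
    rw [degree_eq_natDegree hm.ne_zero, hd]
    exact_mod_cast (by omega : 0 < 1 + 2 * (reducedIter K k).natDegree)
  refine ⟨hm.add_of_left hlt, ?_⟩
  rw [preperiodicPoly, natDegree_add_eq_left_of_degree_lt hlt, hd, pow_succ, ← ih.2]
  ring

lemma eval_zero_preperiodicPoly (k : ℕ) : (preperiodicPoly K k).eval 0 = 2 := by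
  simp [preperiodicPoly]

lemma twistedDeriv_succ (h2 : (2 : K) ≠ 0) (t : K) (k : ℕ) :
    twistedDeriv t (k + 1) =
      C (1 - t * 2⁻¹ ^ (k + 1)) + X * reducedIter K k * twistedDeriv t k := by
  have hC : C (t * 2⁻¹ ^ k) = (2 : K[X]) * C (t * 2⁻¹ ^ (k + 1)) := by
    rw [show (2 : K[X]) = C (2 : K) from rfl, ← C_mul]
    rw [pow_succ, mul_comm 2, mul_assoc, mul_assoc, inv_mul_cancel₀ h2, mul_one]
  have hd : derivative (X * reducedIter K (k + 1)) =
      1 + 2 * (X * reducedIter K k) * derivative (X * reducedIter K k) := by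
    rw [show X * reducedIter K (k + 1) = X + (X * reducedIter K k) ^ 2 by rw [reducedIter]; ring,
      derivative_add, derivative_X, derivative_sq]
    rfl
  rw [twistedDeriv, hd, twistedDeriv, hC, C_sub, reducedIter, C_1]
  ring

lemma natDegree_twistedDeriv_le (t : K) (k : ℕ) :
    (twistedDeriv t k).natDegree ≤ (reducedIter K k).natDegree := by
  refine (natDegree_sub_le _ _).trans (max_le le_rfl ?_)
  refine (natDegree_C_mul_le _ _).trans ((natDegree_derivative_le _).trans ?_)
  rw [natDegree_X_mul (monic_reducedIter k).1.ne_zero]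
  omega

lemma derivative_preperiodicPoly (h2 : (2 : K) ≠ 0) (n : ℕ) :
    derivative (preperiodicPoly K n) = -(reducedIter K n * twistedDeriv (2 ^ (n + 1)) n) := by
  have ht : (2 : K) ^ (n + 1) * 2⁻¹ ^ n = 2 := by
    rw [pow_succ, inv_pow]; field_simp
  rw [twistedDeriv, ht, preperiodicPoly, show (2 : K[X]) = C (2 : K) from rfl]
  simp only [derivative_add, derivative_mul, derivative_X, derivative_sq, derivative_C]
  rw [show (C (2 : K)) = 2 from rfl]
  ring

lemma natDegree_pellForm_of_succ (h2 : (2 : K) ≠ 0) (t : K) {B v : K[X]}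
    (hv : 2 * v.natDegree + 1 ≤ B.natDegree) (k : ℕ)
    (h : (pellForm t B v (k + 1)).natDegree < B.natDegree) :
    (pellForm t B v k).natDegree < B.natDegree := by
  by_cases h0 : pellForm t B v k = 0
  · rw [h0, natDegree_zero]; omega
  have hE := monic_reducedIter (K := K) k
  set e := (reducedIter K k).natDegree with he
  have hw := natDegree_twistedDeriv_le t k
  have key : (X * reducedIter K k) ^ 2 * pellForm t B v k = pellForm t B v (k + 1)
      - C (2 * (1 - t * 2⁻¹ ^ (k + 1))) * (X * (B * (reducedIter K k * twistedDeriv t k)))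
      - C ((1 - t * 2⁻¹ ^ (k + 1)) ^ 2) * B + X * v ^ 2
      + C 2 * (X ^ 2 * (v ^ 2 * reducedIter K k ^ 2)) := by
    simp only [pellForm]
    rw [twistedDeriv_succ h2, reducedIter, C_mul, C_pow, show (C (2 : K)) = 2 from rfl]
    ring
  have hl : ((X * reducedIter K k) ^ 2 * pellForm t B v k).natDegree
      = 2 * (1 + e) + (pellForm t B v k).natDegree := by
    have hm := monic_X.mul hE.1
    rw [(hm.pow 2).natDegree_mul' h0, hm.natDegree_pow, monic_X.natDegree_mul hE.1, natDegree_X]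
  have hr : ((X * reducedIter K k) ^ 2 * pellForm t B v k).natDegree
      ≤ B.natDegree + 2 * e + 1 := by
    rw [key]
    have hX : (X : K[X]).natDegree = 1 := natDegree_X
    have d2 : (C (2 * (1 - t * 2⁻¹ ^ (k + 1))) *
        (X * (B * (reducedIter K k * twistedDeriv t k)))).natDegree ≤ B.natDegree + 2 * e + 1 := by
      refine (natDegree_C_mul_le _ _).trans (natDegree_mul_le.trans ?_)
      have a1 := natDegree_mul_le (p := B) (q := reducedIter K k * twistedDeriv t k)
      have a2 := natDegree_mul_le (p := reducedIter K k) (q := twistedDeriv t k)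
      omega
    have d3 : (C ((1 - t * 2⁻¹ ^ (k + 1)) ^ 2) * B).natDegree ≤ B.natDegree + 2 * e + 1 :=
      (natDegree_C_mul_le _ _).trans (by omega)
    have d4 : (X * v ^ 2).natDegree ≤ B.natDegree + 2 * e + 1 := by
      refine natDegree_mul_le.trans ?_
      have := natDegree_pow_le (p := v) (n := 2)
      omega
    have d5 : (C 2 * (X ^ 2 * (v ^ 2 * reducedIter K k ^ 2))).natDegree
        ≤ B.natDegree + 2 * e + 1 := by
      refine (natDegree_C_mul_le _ _).trans (natDegree_mul_le.trans ?_)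
      have a1 := natDegree_mul_le (p := v ^ 2) (q := reducedIter K k ^ 2)
      have a2 := natDegree_pow_le (p := v) (n := 2)
      have a3 := natDegree_pow_le (p := reducedIter K k) (n := 2)
      have a4 := natDegree_X_pow (R := K) 2
      omega
    refine natDegree_add_le_of_degree_le (natDegree_add_le_of_degree_le
      ((natDegree_sub_le _ _).trans (max_le ((natDegree_sub_le _ _).trans
        (max_le (by omega) d2)) d3)) d4) d5
  omega

lemma natDegree_pellForm_lt (h2 : (2 : K) ≠ 0) (t : K) {B v : K[X]}
    (hv : 2 * v.natDegree + 1 ≤ B.natDegree) {n k : ℕ} (hk : k ≤ n)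
    (h : (pellForm t B v n).natDegree < B.natDegree) :
    (pellForm t B v k).natDegree < B.natDegree :=
  Nat.decreasingInduction (fun k _ hk => natDegree_pellForm_of_succ h2 t hv k hk) h hk

lemma coeff_reducedIter (k : ℕ) :
    (reducedIter K k).coeff 0 = 1 ∧
      (1 ≤ k → (reducedIter K k).coeff 1 = 1) ∧ (2 ≤ k → (reducedIter K k).coeff 2 = 2) := by
  induction k with
  | zero => simp [reducedIter]
  | succ k ih =>
    obtain ⟨h0, h1, -⟩ := ih
    refine ⟨by simp [reducedIter], fun _ => ?_, fun hk => ?_⟩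
    · simp [reducedIter, coeff_one, coeff_X_mul, pow_two, mul_coeff_zero, h0]
    · simp [reducedIter, coeff_one, coeff_X_mul, pow_two, mul_coeff_one, h0, h1 (by omega)]
      norm_num

lemma coeff_twistedDeriv (t : K) (k i : ℕ) :
    (twistedDeriv t k).coeff i = (1 - t * 2⁻¹ ^ k * (i + 1)) * (reducedIter K k).coeff i := by
  rw [twistedDeriv, coeff_sub, coeff_C_mul, coeff_derivative, coeff_X_mul]
  ring

lemma coeff_two_mul_sq (p q : K[X]) : (p * q ^ 2).coeff 2 =
    p.coeff 0 * (2 * q.coeff 0 * q.coeff 2 + q.coeff 1 ^ 2) +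
      p.coeff 1 * (2 * q.coeff 0 * q.coeff 1) + p.coeff 2 * q.coeff 0 ^ 2 := by
  have h2 : Finset.HasAntidiagonal.antidiagonal 2 = ({(0, 2), (1, 1), (2, 0)} : Finset (ℕ × ℕ)) := rfl
  rw [pow_two, coeff_mul, h2]
  simp [coeff_mul q q 2, h2, mul_coeff_one]
  ring

lemma coeff_zero_pellForm (t : K) (B v : K[X]) (k : ℕ) :
    (pellForm t B v k).coeff 0 = B.coeff 0 * (1 - t * 2⁻¹ ^ k) ^ 2 := by
  rw [pellForm, coeff_sub, pow_two, mul_coeff_zero, mul_coeff_zero, coeff_twistedDeriv,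
    (coeff_reducedIter k).1, mul_assoc X, coeff_X_mul_zero]
  push_cast
  ring

lemma coeff_two_pellForm (t : K) (B v : K[X]) {k : ℕ} (hk : 1 ≤ k) :
    (pellForm t B v k).coeff 2 =
      B.coeff 0 * (2 * (1 - t * 2⁻¹ ^ k) * ((1 - 3 * (t * 2⁻¹ ^ k)) * (reducedIter K k).coeff 2)
        + (1 - 2 * (t * 2⁻¹ ^ k)) ^ 2)
      + B.coeff 1 * (2 * (1 - t * 2⁻¹ ^ k) * (1 - 2 * (t * 2⁻¹ ^ k)))
      + B.coeff 2 * (1 - t * 2⁻¹ ^ k) ^ 2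
      - ((v ^ 2).coeff 1 + 2 * (v ^ 2).coeff 0) := by
  obtain ⟨h0, h1, -⟩ := coeff_reducedIter (K := K) k
  rw [pellForm, coeff_sub, coeff_two_mul_sq, mul_assoc X, coeff_X_mul, mul_coeff_one,
    pow_two (reducedIter K k), mul_coeff_one, mul_coeff_zero]
  simp only [coeff_twistedDeriv, h0, h1 hk]
  push_cast
  ring

lemma iterate_eq_sq_eval_reducedIter (c : K) (k : ℕ) :
    (fun z => (z + c) ^ 2)^[k] (c ^ 2) = (c * (reducedIter K k).eval c) ^ 2 := by
  induction k with
  | zero => simp [reducedIter]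
  | succ k ih =>
    rw [Function.iterate_succ_apply', ih, reducedIter]
    simp only [eval_add, eval_one, eval_mul, eval_X, eval_pow]
    ring

lemma isPeriodicPt_of_eval_preperiodicPoly {c : K} {i : ℕ}
    (h : (preperiodicPoly K i).eval c = 0) :
    Function.IsPeriodicPt (fun z => (z + c) ^ 2) (i + 1) (c ^ 2) := by
  have h' : c * (reducedIter K i).eval c ^ 2 = -2 := by
    simp only [preperiodicPoly, eval_add, eval_mul, eval_X, eval_pow, eval_ofNat] at h
    linear_combination h
  rw [Function.IsPeriodicPt, Function.IsFixedPt, iterate_eq_sq_eval_reducedIter, reducedIter]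
  simp only [eval_add, eval_one, eval_mul, eval_X, eval_pow]
  rw [h']
  ring

end Basic

section Annihilator

variable {K : Type*} [Field K]

lemma sum_coeff_mul_of_periodic {y : ℕ → K} {d : ℕ} (hy : ∀ k, y (k + d) = y k) {p : K[X]}
    (hp : X ^ d - 1 ∣ p) {N : ℕ} (hN : p.natDegree < N) (i : ℕ) :
    ∑ k ∈ Finset.range N, p.coeff k * y (k + i) = 0 := by
  set shift : Module.End K (ℕ → K) := LinearMap.funLeft K K Nat.succ
  have hshift : ∀ k i, (shift ^ k) y i = y (k + i) := by
    intro k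
    induction k with
    | zero => simp
    | succ k ih =>
      intro i
      rw [pow_succ', Module.End.mul_apply, LinearMap.funLeft_apply, ih]
      congr 1
      omega
  have h0 : aeval shift p y = 0 := by
    obtain ⟨q, rfl⟩ := hp
    rw [mul_comm, map_mul, Module.End.mul_apply]
    have hy0 : aeval shift (X ^ d - 1 : K[X]) y = 0 := by
      ext i
      simp [hshift, add_comm d, hy]
    rw [hy0, map_zero]
  have := congrFun h0 i
  rw [aeval_eq_sum_range' hN] at this
  simpa [hshift] using this

lemma exists_annihilator {m : ℕ} (hm : 3 ≤ m) :
    ∃ p : K[X], p.natDegree < m - 1 ∧ p.coeff 0 ≠ 0 ∧ p ∣ X ^ m - 1 ∧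
      ∀ d, d ∣ m → d < m → X ^ d - 1 ∣ p := by
  have hprod : (∏ d ∈ m.properDivisors, cyclotomic d K) * cyclotomic m K = X ^ m - 1 := by
    rw [← prod_cyclotomic_eq_X_pow_sub_one (by omega) K, ← Nat.insert_self_properDivisors (by omega),
      Finset.prod_insert Nat.self_notMem_properDivisors, mul_comm]
  have hmonic : (∏ d ∈ m.properDivisors, cyclotomic d K).Monic :=
    monic_prod_of_monic _ _ fun d _ => cyclotomic.monic d K
  refine ⟨∏ d ∈ m.properDivisors, cyclotomic d K, ?_, ?_, ⟨_, hprod.symm⟩, fun d hd hlt => ?_⟩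
  · have hdeg := congrArg natDegree hprod
    rw [hmonic.natDegree_mul (cyclotomic.monic m K), natDegree_cyclotomic,
      show (X ^ m - 1 : K[X]) = X ^ m - C 1 by simp, natDegree_X_pow_sub_C] at hdeg
    have hpos := Nat.totient_pos.2 (show 0 < m by omega)
    obtain ⟨r, hr⟩ := Nat.totient_even (show 2 < m by omega)
    omega
  · intro h
    have := congrArg (coeff · 0) hprod
    simp only [mul_coeff_zero, h, zero_mul] at this
    simp [coeff_X_pow, show ¬ 0 = m by omega] at this
  · have hd0 : 0 < d := Nat.pos_of_dvd_of_pos hd (by omega)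
    rw [← prod_cyclotomic_eq_X_pow_sub_one hd0 K]
    refine Finset.prod_dvd_prod_of_subset _ _ _ fun e he => ?_
    rw [Nat.mem_divisors] at he
    exact Nat.mem_properDivisors.2
      ⟨he.1.trans hd, (Nat.le_of_dvd hd0 he.1).trans_lt hlt⟩

lemma exists_eq_sq_mul_prod_X_sub_C [IsAlgClosed K] {p : K[X]} (hp : p.Monic) :
    ∃ (A : K[X]) (S : Finset K), A.Monic ∧ p = A ^ 2 * ∏ c ∈ S, (X - C c) ∧
      ∀ c ∈ S, Odd (p.rootMultiplicity c) := by
  classical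
  refine ⟨∏ c ∈ p.roots.toFinset, (X - C c) ^ (p.rootMultiplicity c / 2),
    p.roots.toFinset.filter fun c => Odd (p.rootMultiplicity c),
    monic_prod_of_monic _ _ fun c _ => (monic_X_sub_C c).pow _, ?_,
    fun c hc => (Finset.mem_filter.1 hc).2⟩
  conv_lhs => rw [(IsAlgClosed.splits p).eq_prod_roots_of_monic hp,
    Finset.prod_multiset_map_count]
  rw [Finset.prod_filter, ← Finset.prod_pow, ← Finset.prod_mul_distrib]
  refine Finset.prod_congr rfl fun c _ => ?_
  rw [count_roots, ← pow_mul]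
  split_ifs with h
  · rw [← pow_succ]; congr 1; obtain ⟨r, hr⟩ := h; omega
  · rw [mul_one]; congr 1; obtain ⟨r, hr⟩ := Nat.not_odd_iff_even.1 h; omega

end Annihilator

section Core

variable {K : Type*} [Field K]

/-- If `preperiodicPoly K n = A² B`, then `A` divides `twistedDeriv (2 ^ (n + 1)) n`; the quotient
`v` has small degree and makes the last Pell form small. -/
lemma exists_natDegree_pellForm_lt (h2 : (2 : K) ≠ 0) {n : ℕ} {A B : K[X]} (hA : A.Monic)
    (hB : B.Monic) (h : preperiodicPoly K n = A ^ 2 * B) :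
    ∃ v, 2 * v.natDegree + 1 ≤ B.natDegree ∧
      (pellForm (2 ^ (n + 1)) B v n).natDegree < B.natDegree := by
  have hcop : IsCoprime A (reducedIter K n) := by
    have h2' : C (2⁻¹ : K) * 2 = 1 := by
      rw [show (2 : K[X]) = C (2 : K) from rfl, ← C_mul, inv_mul_cancel₀ h2, C_1]
    refine ⟨C 2⁻¹ * (A * B), -(C 2⁻¹ * (X * reducedIter K n)), ?_⟩
    rw [preperiodicPoly] at h
    linear_combination h2' - C (2⁻¹ : K) * h
  have hdvd : A ∣ twistedDeriv (2 ^ (n + 1)) n := by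
    refine hcop.dvd_of_dvd_mul_left ?_
    rw [← dvd_neg, ← derivative_preperiodicPoly h2, h, derivative_mul, derivative_sq]
    exact ⟨C 2 * derivative A * B + A * derivative B, by ring⟩
  obtain ⟨v, hv⟩ := hdvd
  have hw := natDegree_twistedDeriv_le ((2 : K) ^ (n + 1)) n
  have he := (monic_reducedIter (K := K) n).2
  have hd := (monic_preperiodicPoly (K := K) n).2
  rw [h, (hA.pow 2).natDegree_mul hB, hA.natDegree_pow, pow_succ] at hd
  have hdv : 2 * v.natDegree + 1 ≤ B.natDegree := by
    by_cases hv0 : v = 0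
    · rw [hv0, natDegree_zero]; omega
    · rw [hv, hA.natDegree_mul' hv0] at hw
      omega
  refine ⟨v, hdv, ?_⟩
  have hM : pellForm (2 ^ (n + 1)) B v n = C 2 * v ^ 2 := by
    rw [preperiodicPoly] at h
    rw [pellForm, hv, show (C (2 : K)) = 2 from rfl]
    linear_combination -v ^ 2 * h
  rw [hM]
  have := (natDegree_C_mul_le (2 : K) (v ^ 2)).trans natDegree_pow_le
  omega

/-- A linear recurrence satisfied by the forms `pellForm t B v 0, …, pellForm t B v (m - 1)`
contradicts their low order coefficients. -/
lemma false_of_sum_coeff_mul_pellForm_eq_zero (h2 : (2 : K) ≠ 0) {m : ℕ} {p B v : K[X]}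
    (hp : p.natDegree < m - 1) (hp0 : p.coeff 0 ≠ 0) (hp1 : p.eval 1 = 0) (hpm : p ∣ X ^ m - 1)
    (hB : B.coeff 0 ≠ 0) (h : ∀ i ≤ 1, ∑ k ∈ Finset.range (m - 1),
      C (p.coeff k) * pellForm (2 ^ m) B v (k + i) = 0) : False := by
  have hgeom : ∀ r : K, ∀ i, ∑ k ∈ Finset.range (m - 1), p.coeff k * r ^ (k + i) =
      r ^ i * p.eval r := by
    intro r i
    rw [eval_eq_sum_range' hp, Finset.mul_sum]
    exact Finset.sum_congr rfl fun k _ => by ring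
  have hquad : ∀ a b c : K, ∀ i, ∑ k ∈ Finset.range (m - 1), p.coeff k *
      (a + b * 2⁻¹ ^ (k + i) + c * (2⁻¹ ^ 2) ^ (k + i)) =
      b * (2⁻¹ ^ i * p.eval 2⁻¹) + c * ((2⁻¹ ^ 2) ^ i * p.eval (2⁻¹ ^ 2)) := by
    intro a b c i
    have h1 := hgeom 1 i
    rw [hp1, mul_zero] at h1
    rw [← hgeom, ← hgeom, ← add_zero (_ + _), ← mul_zero a, ← h1, Finset.mul_sum, Finset.mul_sum,
      Finset.mul_sum, ← Finset.sum_add_distrib, ← Finset.sum_add_distrib]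
    exact Finset.sum_congr rfl fun k _ => by ring
  have hzero : ∀ i ≤ 1, -2 * 2 ^ m * (2⁻¹ ^ i * p.eval 2⁻¹) +
      (2 ^ m) ^ 2 * ((2⁻¹ ^ 2) ^ i * p.eval (2⁻¹ ^ 2)) = 0 := by
    intro i hi
    have := congrArg (coeff · 0) (h i hi)
    simp only [finsetSum_coeff, coeff_C_mul, coeff_zero_pellForm, coeff_zero] at this
    rw [← hquad 1]
    refine (mul_eq_zero.1 ?_).resolve_left hB
    rw [← this, Finset.mul_sum]
    exact Finset.sum_congr rfl fun k _ => by ring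
  have ht : (2 : K) ^ m ≠ 0 := pow_ne_zero _ h2
  have e0 := hzero 0 (by norm_num)
  have e1 := hzero 1 le_rfl
  have hr : (2 : K) * 2⁻¹ = 1 := mul_inv_cancel₀ h2
  have hhalf : p.eval 2⁻¹ = 0 := by
    refine (mul_eq_zero.1 ?_).resolve_left (mul_ne_zero h2 ht)
    generalize p.eval (2⁻¹ ^ 2) = y at e0 e1
    generalize p.eval 2⁻¹ = x at e0 e1 ⊢
    generalize (2⁻¹ : K) = r at e0 e1 hr
    linear_combination e0 - 4 * e1 + (-4 * 2 ^ m * x + (2 ^ m) ^ 2 * y * (2 * r + 1)) * hr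
  have hquarter : p.eval (2⁻¹ ^ 2) = 0 := by
    refine (mul_eq_zero.1 ?_).resolve_left (pow_ne_zero 2 ht)
    rw [hhalf] at e0
    linear_combination e0
  have hone : (2 : K) ^ m = 1 := by
    have := eval_dvd hpm (x := (2⁻¹ : K))
    rw [hhalf, zero_dvd_iff] at this
    simp only [eval_sub, eval_pow, eval_X, eval_one, inv_pow] at this
    exact inv_eq_one.1 (sub_eq_zero.1 this)
  have htwo := congrArg (coeff · 2) (h 1 le_rfl)
  simp only [finsetSum_coeff, coeff_C_mul, coeff_zero, hone] at htwo
  have hterm : ∀ k, (pellForm 1 B v (k + 1)).coeff 2 =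
      ((5 * B.coeff 0 + 2 * B.coeff 1 + B.coeff 2 - ((v ^ 2).coeff 1 + 2 * (v ^ 2).coeff 0)) +
        (-20 * B.coeff 0 - 6 * B.coeff 1 - 2 * B.coeff 2) * 2⁻¹ ^ (k + 1) +
        (16 * B.coeff 0 + 4 * B.coeff 1 + B.coeff 2) * (2⁻¹ ^ 2) ^ (k + 1)) +
        if k = 0 then B.coeff 0 else 0 := by
    intro k
    rw [coeff_two_pellForm _ _ _ (by omega)]
    generalize (2⁻¹ : K) = r at hr
    split_ifs with hk
    · subst hk
      have hc : (reducedIter K (0 + 1)).coeff 2 = 0 := by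
        simp [reducedIter, coeff_one, coeff_X]
      rw [hc]
      linear_combination (-B.coeff 0 * (6 * r - 5)) * hr
    · rw [(coeff_reducedIter (K := K) (k + 1)).2.2 (by omega)]
      ring
  simp only [hterm, mul_add (p.coeff _) (_ + _) (ite _ _ _)] at htwo
  rw [Finset.sum_add_distrib, hquad, hhalf, hquarter] at htwo
  simp [show 0 < m - 1 by omega] at htwo
  exact htwo.elim hp0 hB

lemma exists_odd_rootMultiplicity [IsAlgClosed K] (h2 : (2 : K) ≠ 0) {n : ℕ} (hn : 2 ≤ n) :
    ∃ c, Odd ((preperiodicPoly K n).rootMultiplicity c) ∧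
      ∀ i < n, (preperiodicPoly K i).eval c ≠ 0 := by
  by_contra! hcon
  obtain ⟨A, S, hA, hAB, hS⟩ := exists_eq_sq_mul_prod_X_sub_C (monic_preperiodicPoly (K := K) n).1
  set B := ∏ c ∈ S, (X - C c) with hBdef
  have hB : B.Monic := monic_prod_of_monic _ _ fun c _ => monic_X_sub_C c
  have hBdeg : B.natDegree = S.card := by rw [hBdef]; simp [natDegree_finsetProd_X_sub_C_eq_card]
  obtain ⟨v, hv, hlt⟩ := exists_natDegree_pellForm_lt h2 hA hB hAB
  obtain ⟨p, hp, hp0, hpm, hpd⟩ := exists_annihilator (K := K) (show 3 ≤ n + 1 by omega)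
  have hp1 : p.eval 1 = 0 := by
    have := eval_dvd (hpd 1 (one_dvd _) (by omega)) (x := (1 : K))
    simpa using this
  have hB0 : B.coeff 0 ≠ 0 := by
    intro h0
    have := eval_zero_preperiodicPoly (K := K) n
    rw [hAB, eval_mul, ← coeff_zero_eq_eval_zero B, h0, mul_zero] at this
    exact h2 this.symm
  refine false_of_sum_coeff_mul_pellForm_eq_zero h2 hp hp0 hp1 hpm hB0
    (v := v) fun i hi => ?_
  refine eq_zero_of_degree_lt_of_eval_finset_eq_zero S ?_ fun c hc => ?_
  · rw [← hBdeg]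
    refine (degree_sum_le _ _).trans_lt ((Finset.sup_lt_iff (WithBot.bot_lt_coe _)).2 fun k hk => ?_)
    rw [Finset.mem_range] at hk
    refine degree_le_natDegree.trans_lt (Nat.cast_lt.2 ((natDegree_C_mul_le _ _).trans_lt ?_))
    exact natDegree_pellForm_lt h2 _ hv (by omega) hlt
  · obtain ⟨j, hj, hjc⟩ := hcon c (hS c hc)
    have hnc : (preperiodicPoly K n).eval c = 0 := by
      by_contra hne
      have := hS c hc
      rw [rootMultiplicity_eq_zero hne] at this
      simp at this
    have hc0 : c ≠ 0 := by
      rintro rfl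
      exact h2 ((eval_zero_preperiodicPoly n).symm.trans hnc)
    have hper := (isPeriodicPt_of_eval_preperiodicPoly hjc).gcd
      (isPeriodicPt_of_eval_preperiodicPoly hnc)
    set d := (j + 1).gcd (n + 1)
    have hdn : d < n + 1 := (Nat.gcd_le_left _ (by omega)).trans_lt (by omega)
    have hy : ∀ k, (c * (reducedIter K (k + d)).eval c) ^ 2 = (c * (reducedIter K k).eval c) ^ 2 := by
      intro k
      rw [← iterate_eq_sq_eval_reducedIter, ← iterate_eq_sq_eval_reducedIter,
        Function.iterate_add_apply, hper.eq]
    have hsum := sum_coeff_mul_of_periodic (y := fun k => (c * (reducedIter K k).eval c) ^ 2) hy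
      (hpd d (Nat.gcd_dvd_right _ _) hdn) hp i
    have hBc : B.eval c = 0 := by
      rw [hBdef, eval_prod]
      exact Finset.prod_eq_zero hc (by simp)
    have hsq : c ^ 2 * ∑ k ∈ Finset.range (n + 1 - 1),
        p.coeff k * (reducedIter K (k + i)).eval c ^ 2 = 0 := by
      rw [← hsum, Finset.mul_sum]
      exact Finset.sum_congr rfl fun k _ => by ring
    rw [eval_finsetSum, ← mul_zero (-(c * v.eval c ^ 2)),
      ← (mul_eq_zero.1 hsq).resolve_left (pow_ne_zero 2 hc0), Finset.mul_sum]
    refine Finset.sum_congr rfl fun k _ => ?_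
    simp only [pellForm, eval_mul, eval_C, eval_sub, eval_pow, eval_X, hBc]
    ring

end Core

section Main

variable {K : Type*} [Field K]

lemma rootMultiplicity_X_sub_C_mul {c : K} {R : K[X]} (hR : R.eval c ≠ 0) :
    ((X - C c) * R).rootMultiplicity c = 1 := by
  have hR0 : R ≠ 0 := by rintro rfl; simp at hR
  rw [rootMultiplicity_mul (mul_ne_zero (X_sub_C_ne_zero c) hR0), rootMultiplicity_X_sub_C_self,
    rootMultiplicity_eq_zero hR]

lemma even_rootMultiplicity_of_mul_eq_sq {P Q R : K[X]} {c : K} (hQ : Q ≠ 0) (hR : R.eval c ≠ 0)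
    (h : R * Q = P ^ 2) : Even (Q.rootMultiplicity c) := by
  classical
  have hR0 : R ≠ 0 := by rintro rfl; simp at hR
  have hm := rootMultiplicity_mul (x := c) (mul_ne_zero hR0 hQ)
  rw [rootMultiplicity_eq_zero hR, zero_add, h, ← count_roots, roots_pow, Multiset.count_nsmul]
    at hm
  rw [← hm]
  exact even_two_mul _

/-- Some critically preperiodic parameter of exact period `n + 1` has odd multiplicity. -/
lemma exists_odd_primitive_root [IsAlgClosed K] (h2 : (2 : K) ≠ 0) (n : ℕ) :
    ∃ c, Odd ((preperiodicPoly K n).rootMultiplicity c) ∧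
      ∀ i < n, (preperiodicPoly K i).eval c ≠ 0 := by
  have hzero : preperiodicPoly K 0 = X + 2 := by simp [preperiodicPoly, reducedIter]
  match n with
  | 0 =>
    refine ⟨-2, ?_, by simp⟩
    rw [hzero, show (X + 2 : K[X]) = (X - C (-2)) * 1 by rw [C_neg, sub_neg_eq_add, mul_one]; rfl,
      rootMultiplicity_X_sub_C_mul (by simp)]
    exact odd_one
  | 1 =>
    have hroot : ∃ c : K, c ^ 2 = -1 ∧ c + 2 ≠ 0 := by
      obtain ⟨c, hc⟩ := IsAlgClosed.exists_pow_nat_eq (-1 : K) (n := 2) (by norm_num)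
      by_cases h : c + 2 = 0
      · refine ⟨-c, by rw [neg_sq, hc], fun h' => mul_ne_zero h2 h2 ?_⟩
        linear_combination h + h'
      · exact ⟨c, hc, h⟩
    obtain ⟨c, hc, hc2⟩ := hroot
    have hc0 : c ≠ 0 := by
      rintro rfl
      simp at hc
    refine ⟨c, ?_, fun i hi => ?_⟩
    · have hC : C c ^ 2 = (-1 : K[X]) := by rw [← C_pow, hc, C_neg, C_1]
      have hfac : preperiodicPoly K 1 = (X - C c) * ((X + C c) * (X + 2)) := by
        simp only [preperiodicPoly, reducedIter]
        linear_combination (X + 2) * hC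
      rw [hfac, rootMultiplicity_X_sub_C_mul]
      · exact odd_one
      · simp only [eval_mul, eval_add, eval_X, eval_C, eval_ofNat, ← two_mul]
        exact mul_ne_zero (mul_ne_zero h2 hc0) hc2
    · obtain rfl : i = 0 := by omega
      simpa [hzero] using hc2
  | n + 2 => exact exists_odd_rootMultiplicity h2 (by omega)

lemma prod_Gpoly_ne_sq [IsAlgClosed K] (h2 : (2 : K) ≠ 0) {J : Finset ℕ} (hJ : J.Nonempty)
    (hpos : ∀ j ∈ J, 0 < j) (P : K[X]) : ∏ j ∈ J, Gpoly K j ≠ P ^ 2 := by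
  intro h
  obtain ⟨n, hn⟩ := Nat.exists_eq_add_one.2 (hpos _ (J.max'_mem hJ))
  obtain ⟨c, hodd, hprim⟩ := exists_odd_primitive_root h2 n
  have hc0 : c ≠ 0 := by
    rintro rfl
    rw [rootMultiplicity_eq_zero] at hodd
    · simp at hodd
    · rwa [IsRoot, eval_zero_preperiodicPoly]
  rw [← Finset.mul_prod_erase J _ (J.max'_mem hJ), hn, Gpoly_succ] at h
  refine Nat.not_even_iff_odd.2 hodd (even_rootMultiplicity_of_mul_eq_sq (P := P)
    (R := -X * ∏ j ∈ J.erase (n + 1), Gpoly K j) (monic_preperiodicPoly n).1.ne_zero ?_ ?_)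
  · rw [eval_mul, eval_prod]
    refine mul_ne_zero (by simpa using hc0) (Finset.prod_ne_zero_iff.2 fun j hj => ?_)
    rw [Finset.mem_erase] at hj
    obtain ⟨i, rfl⟩ := Nat.exists_eq_add_one.2 (hpos j hj.2)
    have hle := J.le_max' _ hj.2
    rw [Gpoly_succ, eval_neg, eval_mul, eval_X]
    exact neg_ne_zero.2 (mul_ne_zero hc0 (hprim i (by omega)))
  · rw [← h]; ring

end Main

lemma map_Fiter {F K : Type*} [Field F] [Field K] (f : F →+* K) (k : ℕ) :
    (Fiter F k).map f = Fiter K k := by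
  induction k with
  | zero => simp [Fiter]
  | succ k ih => simp [Fiter, ih]

lemma map_Gpoly {F K : Type*} [Field F] [Field K] (f : F →+* K) (k : ℕ) :
    (Gpoly F k).map f = Gpoly K k := by
  simp [Gpoly, map_Fiter]

theorem stmt7 (F : Type*) [Field F] [Fintype F] (hq : Odd (Fintype.card F))
    (J : Finset ℕ) (hJ : J.Nonempty) (hpos : ∀ j ∈ J, 0 < j)
    (P : Polynomial (AlgebraicClosure F)) :
    (∏ j ∈ J, Gpoly F j).map (algebraMap F (AlgebraicClosure F)) ≠ P ^ 2 := by
  rw [Polynomial.map_prod]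
  simp only [map_Gpoly]
  refine prod_Gpoly_ne_sq (fun h => ?_) hJ hpos P
  have h2 : (2 : F) = 0 := by
    apply (algebraMap F (AlgebraicClosure F)).injective
    rw [map_ofNat, map_zero, h]
  have hchar : ringChar F = 2 := CharP.ringChar_of_prime_eq_zero Nat.prime_two (by exact_mod_cast h2)
  exact Nat.not_even_iff_odd.2 hq
    (Nat.even_iff.2 (FiniteField.even_card_of_char_two hchar))
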